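/- Let h_1, h_2 be holomorphic on an open disk D(z_0, r_0) with h_1(z_0) ≠ 0, and for each ε > 0 let h_{i,ε} = h_i + χ_{i,ε} with sup_{D(z_0,r_0)}|χ_{i,ε}| → 0 as ε → 0. Let z_{0,ε} → z_0. Then there exist ε_0 > 0 and r > 0 such that for 0 < ε ≤ ε_0 the equation (z − z_{0,ε})³ − ε(z − z_{0,ε})h_{1,ε}(z) + ε²h_{2,ε}(z) = 0 has exactly three solutions in D(z_0, r), of the form z_ε^± = z_{0,ε} ± √ε·√(h_1(z_0)) + o(√ε) and z_ε = z_{0,ε} + ε·h_2(z_0)/h_1(z_0) + o(ε), where √· is an analytic branch of the square root near h_1(z_0). -/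

import Mathlib

open Filter Topology Metric

/-- A simple zero `c` of `P` persists, uniquely near `c`, under holomorphic perturbations tending
uniformly to zero. -/
theorem HasStrictDerivAt.exists_tendsto_zero_of_perturbation {ι : Type*} {l : Filter ι} [l.NeBot]
    {P : ℂ → ℂ} {c d : ℂ} {R : ℝ} {E : ι → ℂ → ℂ} (hP : HasStrictDerivAt P d c) (hd : d ≠ 0)
    (hPc : P c = 0) (hR : 0 < R)
    (hEd : ∀ᶠ i in l, DifferentiableOn ℂ (E i) (ball c R))
    (hE : ∀ η : ℝ, 0 < η → ∀ᶠ i in l, ∀ v ∈ ball c R, ‖E i v‖ ≤ η) :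
    ∃ ρ : ℝ, 0 < ρ ∧ ∃ V : ι → ℂ, Tendsto V l (𝓝 c) ∧
      ∀ᶠ i in l, P (V i) + E i (V i) = 0 ∧
        ∀ v ∈ closedBall c ρ, P v + E i v = 0 → v = V i := by
  have hP' := hP.hasStrictFDerivAt_equiv hd
  set f' : ℂ ≃L[ℂ] ℂ := ContinuousLinearEquiv.unitsEquivAut ℂ (Units.mk0 d hd) with hf'
  set N : NNReal := ‖(f'.symm : ℂ →L[ℂ] ℂ)‖₊ with hN
  have hNpos : 0 < N⁻¹ := by
    rw [inv_pos]
    rcases f'.subsingleton_or_nnnorm_symm_pos with h | h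
    · exact absurd h (not_subsingleton ℂ)
    · exact h
  obtain ⟨S, hS, hPS⟩ := hP'.approximates_deriv_on_nhds (c := N⁻¹ / 4) (Or.inr (by positivity))
  obtain ⟨ρ₁, hρ₁, hρS⟩ := Metric.nhds_basis_closedBall.mem_iff.1 hS
  set ρ := min ρ₁ (R / 2) with hρ
  have hρpos : 0 < ρ := by positivity
  have key : ∀ ρ' : ℝ, 0 < ρ' → ρ' ≤ ρ → ∀ᶠ i in l,
      (∃ v ∈ closedBall c ρ', P v + E i v = 0) ∧
      Set.InjOn (fun v => P v + E i v) (closedBall c ρ) := by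
    intro ρ' h0 hle
    have hNpos' : (0 : ℝ) < (N⁻¹ : NNReal) := by exact_mod_cast hNpos
    filter_upwards [hEd, hE ((N⁻¹ : NNReal) / 4 * (R / 4)) (by positivity),
      hE ((N⁻¹ : NNReal) / 2 * ρ') (by positivity)] with i hdi h1 h2
    have hlip : ∀ x ∈ closedBall c ρ, ∀ y ∈ closedBall c ρ,
        ‖E i y - E i x‖ ≤ (N⁻¹ : NNReal) / 4 * ‖y - x‖ := by
      intro x hx y hy
      have hsub : closedBall c ρ ⊆ ball c R := closedBall_subset_ball (by
        have := min_le_right ρ₁ (R / 2); linarith)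
      refine Convex.norm_image_sub_le_of_norm_deriv_le (𝕜 := ℂ)
        (fun z hz => hdi.differentiableAt (isOpen_ball.mem_nhds (hsub hz))) ?_
        (convex_closedBall c ρ) hx hy
      intro z hz
      have hzR : closedBall z (R / 4) ⊆ ball c R := by
        intro u hu
        have h3 := min_le_right ρ₁ (R / 2)
        rw [mem_closedBall] at hu hz
        rw [mem_ball]
        have := dist_triangle u z c
        linarith
      have := Complex.norm_deriv_le_of_forall_mem_sphere_norm_le (c := z) (R := R / 4)
        (f := E i) (C := (N⁻¹ : NNReal) / 4 * (R / 4)) (by positivity)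
        (hdi.diffContOnCl_ball hzR)
        (fun u hu => h1 u (hzR (sphere_subset_closedBall hu)))
      rwa [mul_div_assoc, div_self (by positivity), mul_one] at this
    have happ : ApproximatesLinearOn (fun v => P v + E i v) (f' : ℂ →L[ℂ] ℂ)
        (closedBall c ρ) (N⁻¹ / 2) := by
      intro x hx y hy
      have hsub : closedBall c ρ ⊆ S :=
        (closedBall_subset_closedBall (min_le_left _ _)).trans hρS
      have h3 := hPS x (hsub hx) y (hsub hy)
      have h4 := hlip y hy x hx
      have h5 : P x + E i x - (P y + E i y) - (f' : ℂ →L[ℂ] ℂ) (x - y)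
          = (P x - P y - (f' : ℂ →L[ℂ] ℂ) (x - y)) + (E i x - E i y) := by ring
      simp only [h5]
      refine (norm_add_le _ _).trans ?_
      push_cast at h3 h4 ⊢
      linarith
    constructor
    · have hsurj := happ.surjOn_closedBall_of_nonlinearRightInverse
        f'.toNonlinearRightInverse h0.le (closedBall_subset_closedBall hle)
      have h0mem : (0 : ℂ) ∈ closedBall (P c + E i c)
          ((((f'.toNonlinearRightInverse).nnnorm : ℝ)⁻¹ - ((N⁻¹ / 2 : NNReal) : ℝ)) * ρ') := by
        have hnn : (f'.toNonlinearRightInverse).nnnorm = N := rfl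
        rw [hnn, mem_closedBall, dist_comm, dist_zero_right, hPc, zero_add]
        refine (h2 c (mem_ball_self hR)).trans (le_of_eq ?_)
        push_cast
        ring
      obtain ⟨v, hv, hv0⟩ := hsurj h0mem
      exact ⟨v, hv, hv0⟩
    · exact happ.injOn (Or.inr (NNReal.half_lt_self hNpos.ne'))
  obtain ⟨V, hV⟩ := ((key ρ hρpos le_rfl).mono fun i hi =>
    (⟨hi.1.choose, hi.1.choose_spec, hi.2⟩ : ∃ v, (v ∈ closedBall c ρ ∧ P v + E i v = 0) ∧
      Set.InjOn (fun v => P v + E i v) (closedBall c ρ))).choice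
  refine ⟨ρ, hρpos, V, ?_, ?_⟩
  · rw [Metric.nhds_basis_closedBall.tendsto_right_iff]
    intro r hr
    filter_upwards [hV, key (min r ρ) (by positivity) (min_le_right _ _)]
      with i hi ⟨⟨v, hv, hv0⟩, _⟩
    have : v = V i := hi.2 (closedBall_subset_closedBall (min_le_right _ _) hv) hi.1.1
      (hv0.trans hi.1.2.symm)
    exact this ▸ closedBall_subset_closedBall (min_le_left _ _) hv
  · filter_upwards [hV] with i hi
    exact ⟨hi.1.2, fun v hv hv0 => hi.2 hv hi.1.1 (hv0.trans hi.1.2.symm)⟩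

/-- Bounded sets rescaled by `√ε` shrink to the limiting center. -/
theorem eventually_forall_add_sqrt_mul_mem_ball {z₀ : ℂ} {δ : ℝ → ℂ}
    (hδ : Tendsto δ (𝓝[>] (0 : ℝ)) (𝓝 0)) (R : ℝ) {ρ : ℝ} (hρ : 0 < ρ) :
    ∀ᶠ ε in 𝓝[>] (0 : ℝ), ∀ v ∈ ball (0 : ℂ) R,
      z₀ + δ ε + (Real.sqrt ε : ℂ) * v ∈ ball z₀ ρ := by
  have hs : Tendsto (fun ε : ℝ => Real.sqrt ε) (𝓝[>] (0 : ℝ)) (𝓝 0) := by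
    simpa using (Real.continuous_sqrt.tendsto 0).mono_left nhdsWithin_le_nhds
  have h : Tendsto (fun ε : ℝ => ‖δ ε‖ + Real.sqrt ε * R) (𝓝[>] (0 : ℝ)) (𝓝 0) := by
    simpa using hδ.norm.add (hs.mul_const R)
  filter_upwards [h.eventually (gt_mem_nhds hρ)] with ε hε v hv
  rw [mem_ball_zero_iff] at hv
  rw [mem_ball_iff_norm]
  have h1 : z₀ + δ ε + (Real.sqrt ε : ℂ) * v - z₀ = δ ε + (Real.sqrt ε : ℂ) * v := by ring
  rw [h1]
  refine (norm_add_le _ _).trans_lt (lt_of_le_of_lt ?_ hε)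
  rw [norm_mul, Complex.norm_real, Real.norm_of_nonneg (Real.sqrt_nonneg ε)]
  gcongr

theorem eventually_norm_rescale_sub_le {z₀ : ℂ} {r₀ : ℝ} (hr₀ : 0 < r₀) {h : ℂ → ℂ}
    {χ : ℝ → ℂ → ℂ} {δ : ℝ → ℂ} (hh : ContinuousAt h z₀)
    (hχ : ∀ η : ℝ, 0 < η → ∀ᶠ ε in 𝓝[>] (0 : ℝ), ∀ z ∈ ball z₀ r₀, ‖χ ε z‖ ≤ η)
    (hδ : Tendsto δ (𝓝[>] (0 : ℝ)) (𝓝 0)) (R : ℝ) {η : ℝ} (hη : 0 < η) :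
    ∀ᶠ ε in 𝓝[>] (0 : ℝ), ∀ v ∈ ball (0 : ℂ) R,
      ‖h (z₀ + δ ε + (Real.sqrt ε : ℂ) * v) + χ ε (z₀ + δ ε + (Real.sqrt ε : ℂ) * v) - h z₀‖
        ≤ η := by
  obtain ⟨ρ, hρ, hρh⟩ := Metric.continuousAt_iff.1 hh (η / 2) (by positivity)
  filter_upwards [eventually_forall_add_sqrt_mul_mem_ball (z₀ := z₀) hδ R hρ,
    eventually_forall_add_sqrt_mul_mem_ball (z₀ := z₀) hδ R hr₀, hχ (η / 2) (by positivity)]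
    with ε h1 h2 h3 v hv
  have h4 := hρh (h1 v hv)
  have h5 := h3 _ (h2 v hv)
  rw [dist_eq_norm] at h4
  rw [add_sub_right_comm]
  refine (norm_add_le _ _).trans ?_
  linarith

theorem norm_le_of_cube_eq {v a b : ℂ} {M : ℝ} (ha : ‖a‖ ≤ M) (hb : ‖b‖ ≤ M)
    (h : v ^ 3 - v * a + b = 0) : ‖v‖ ≤ M + 1 := by
  by_contra! hv
  have hM : 0 ≤ M := (norm_nonneg a).trans ha
  have h1 : v ^ 3 = v * a - b := by linear_combination h
  have h2 : ‖v‖ ^ 3 ≤ ‖v‖ * M + M := by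
    rw [← norm_pow, h1]
    refine (norm_sub_le _ _).trans ?_
    rw [norm_mul]
    gcongr
  have h3 : (M + 1) ^ 2 * ‖v‖ ≤ ‖v‖ ^ 3 := by
    have : (M + 1) ^ 2 ≤ ‖v‖ ^ 2 := by gcongr
    nlinarith [norm_nonneg v]
  nlinarith [mul_nonneg hM (norm_nonneg v)]

/-- A point where `v ^ 3 - s ^ 2 * v` is small is close to one of the roots. -/
theorem norm_le_of_norm_mul_sub_mul_add_le {v s : ℂ} {ρ₁ ρ₂ ρ₃ : ℝ} (h₁ : 0 < ρ₁) (h₂ : 0 < ρ₂)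
    (h₃ : 0 < ρ₃) (h : ‖v ^ 3 - s ^ 2 * v‖ ≤ ρ₁ * ρ₂ * ρ₃) :
    v ∈ closedBall (-s) ρ₁ ∨ v ∈ closedBall s ρ₂ ∨ v ∈ closedBall 0 ρ₃ := by
  by_contra! hc
  simp only [mem_closedBall, dist_eq_norm, not_le, sub_neg_eq_add, sub_zero] at hc
  obtain ⟨c1, c2, c3⟩ := hc
  have h4 : v ^ 3 - s ^ 2 * v = (v + s) * (v - s) * v := by ring
  rw [h4, norm_mul, norm_mul] at h
  have : ρ₁ * ρ₂ * ρ₃ < ‖v + s‖ * ‖v - s‖ * ‖v‖ := by gcongr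
  linarith

/-- Cubic perturbation lemma: with h₁, h₂ holomorphic on D(z₀, r₀),
h₁(z₀) ≠ 0, h_{i,ε} = h_i + χ_{i,ε} with sup|χ_{i,ε}| → 0, and z_{0,ε} → z₀,
the equation (z − z_{0,ε})³ − ε(z − z_{0,ε})h_{1,ε}(z) + ε²h_{2,ε}(z) = 0 has
exactly three solutions in a fixed small disk D(z₀, r) for all small ε > 0,
of the form z_ε^± = z_{0,ε} ± √ε·√(h₁(z₀)) + o(√ε) and
z_ε = z_{0,ε} + ε·h₂(z₀)/h₁(z₀) + o(ε). -/
theorem stmt_7 (z₀ : ℂ) (r₀ : ℝ) (hr₀ : 0 < r₀)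
    (h₁ h₂ : ℂ → ℂ) (χ₁ χ₂ : ℝ → ℂ → ℂ) (δ : ℝ → ℂ)
    (hh₁ : DifferentiableOn ℂ h₁ (ball z₀ r₀))
    (hh₂ : DifferentiableOn ℂ h₂ (ball z₀ r₀))
    (hne : h₁ z₀ ≠ 0)
    (hχ₁diff : ∀ ε : ℝ, 0 < ε → DifferentiableOn ℂ (χ₁ ε) (ball z₀ r₀))
    (hχ₂diff : ∀ ε : ℝ, 0 < ε → DifferentiableOn ℂ (χ₂ ε) (ball z₀ r₀))
    (hχ₁sup : ∀ η : ℝ, 0 < η → ∃ ε₁ : ℝ, 0 < ε₁ ∧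
      ∀ ε : ℝ, 0 < ε → ε ≤ ε₁ → ∀ z ∈ ball z₀ r₀, ‖χ₁ ε z‖ ≤ η)
    (hχ₂sup : ∀ η : ℝ, 0 < η → ∃ ε₁ : ℝ, 0 < ε₁ ∧
      ∀ ε : ℝ, 0 < ε → ε ≤ ε₁ → ∀ z ∈ ball z₀ r₀, ‖χ₂ ε z‖ ≤ η)
    (hδ : Tendsto δ (𝓝[>] (0 : ℝ)) (𝓝 0)) :
    ∃ ε₀ : ℝ, 0 < ε₀ ∧ ∃ r : ℝ, 0 < r ∧ r < r₀ ∧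
    ∃ s : ℂ, s ^ 2 = h₁ z₀ ∧ ∃ Zm Zp Z : ℝ → ℂ,
      (∀ ε : ℝ, 0 < ε → ε ≤ ε₀ →
        (Zm ε ∈ ball z₀ r ∧ Zp ε ∈ ball z₀ r ∧ Z ε ∈ ball z₀ r) ∧
        (Zm ε ≠ Zp ε ∧ Zm ε ≠ Z ε ∧ Zp ε ≠ Z ε) ∧
        (∀ w, (w = Zm ε ∨ w = Zp ε ∨ w = Z ε) →
          (w - (z₀ + δ ε)) ^ 3
            - (ε : ℂ) * (w - (z₀ + δ ε)) * (h₁ w + χ₁ ε w)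
            + (ε : ℂ) ^ 2 * (h₂ w + χ₂ ε w) = 0) ∧
        (∀ z ∈ ball z₀ r,
          (z - (z₀ + δ ε)) ^ 3
            - (ε : ℂ) * (z - (z₀ + δ ε)) * (h₁ z + χ₁ ε z)
            + (ε : ℂ) ^ 2 * (h₂ z + χ₂ ε z) = 0 →
          z = Zm ε ∨ z = Zp ε ∨ z = Z ε)) ∧
      Tendsto (fun ε : ℝ =>
          (Zm ε - (z₀ + δ ε) + (Real.sqrt ε : ℂ) * s) / (Real.sqrt ε : ℂ))
        (𝓝[>] (0 : ℝ)) (𝓝 0) ∧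
      Tendsto (fun ε : ℝ =>
          (Zp ε - (z₀ + δ ε) - (Real.sqrt ε : ℂ) * s) / (Real.sqrt ε : ℂ))
        (𝓝[>] (0 : ℝ)) (𝓝 0) ∧
      Tendsto (fun ε : ℝ =>
          (Z ε - (z₀ + δ ε) - (ε : ℂ) * (h₂ z₀ / h₁ z₀)) / (ε : ℂ))
        (𝓝[>] (0 : ℝ)) (𝓝 0) := by
  have hχ₁ : ∀ η : ℝ, 0 < η → ∀ᶠ ε in 𝓝[>] (0 : ℝ), ∀ z ∈ ball z₀ r₀, ‖χ₁ ε z‖ ≤ η := by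
    intro η hη
    obtain ⟨e, he, H⟩ := hχ₁sup η hη
    filter_upwards [Ioc_mem_nhdsGT he] with ε hε using H ε hε.1 hε.2
  have hχ₂ : ∀ η : ℝ, 0 < η → ∀ᶠ ε in 𝓝[>] (0 : ℝ), ∀ z ∈ ball z₀ r₀, ‖χ₂ ε z‖ ≤ η := by
    intro η hη
    obtain ⟨e, he, H⟩ := hχ₂sup η hη
    filter_upwards [Ioc_mem_nhdsGT he] with ε hε using H ε hε.1 hε.2
  have hc₁ : ContinuousAt h₁ z₀ := (hh₁.differentiableAt (ball_mem_nhds z₀ hr₀)).continuousAt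
  have hc₂ : ContinuousAt h₂ z₀ := (hh₂.differentiableAt (ball_mem_nhds z₀ hr₀)).continuousAt
  obtain ⟨s, hs⟩ := IsAlgClosed.exists_pow_nat_eq (h₁ z₀) two_pos
  have hs0 : s ≠ 0 := by rintro rfl; exact hne (by simpa using hs.symm)
  have hr : r₀ / 2 < r₀ := by linarith
  have hsubr : ball z₀ (r₀ / 2) ⊆ ball z₀ r₀ := ball_subset_ball hr.le
  have hcomp : IsCompact (closedBall z₀ (r₀ / 2)) := isCompact_closedBall _ _
  obtain ⟨M₁, hM₁⟩ := hcomp.exists_bound_of_continuousOn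
    (hh₁.continuousOn.mono (closedBall_subset_ball hr))
  obtain ⟨M₂, hM₂⟩ := hcomp.exists_bound_of_continuousOn
    (hh₂.continuousOn.mono (closedBall_subset_ball hr))
  set M : ℝ := max M₁ M₂ + 1 with hM
  have hMpos : 0 < M := by
    have h1 := (norm_nonneg _).trans (hM₁ z₀ (mem_closedBall_self (by positivity)))
    have h2 := le_max_left M₁ M₂
    linarith
  set R : ℝ := M + 2 + ‖s‖ with hR
  have hRpos : 0 < R := by positivity
  let p : ℝ → ℂ → ℂ := fun ε v => z₀ + δ ε + (Real.sqrt ε : ℂ) * v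
  let H₁ : ℝ → ℂ → ℂ := fun ε v => h₁ (p ε v) + χ₁ ε (p ε v)
  let H₂ : ℝ → ℂ → ℂ := fun ε v => h₂ (p ε v) + χ₂ ε (p ε v)
  let P : ℂ → ℂ := fun v => v ^ 3 - s ^ 2 * v
  let E : ℝ → ℂ → ℂ := fun ε v => v * (s ^ 2 - H₁ ε v) + (Real.sqrt ε : ℂ) * H₂ ε v
  have hsqrt : Tendsto (fun ε : ℝ => Real.sqrt ε) (𝓝[>] (0 : ℝ)) (𝓝 0) := by
    simpa using (Real.continuous_sqrt.tendsto 0).mono_left nhdsWithin_le_nhds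
  have hsqrtC : Tendsto (fun ε : ℝ => (Real.sqrt ε : ℂ)) (𝓝[>] (0 : ℝ)) (𝓝 0) := by
    simpa [Function.comp_def] using (Complex.continuous_ofReal.tendsto 0).comp hsqrt
  have hpos : ∀ᶠ ε in 𝓝[>] (0 : ℝ), 0 < ε := eventually_mem_nhdsWithin
  have hH₁ : ∀ η : ℝ, 0 < η → ∀ᶠ ε in 𝓝[>] (0 : ℝ), ∀ v ∈ ball (0 : ℂ) R,
      ‖H₁ ε v - h₁ z₀‖ ≤ η :=
    fun η hη => eventually_norm_rescale_sub_le hr₀ hc₁ hχ₁ hδ R hη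
  have hH₂ : ∀ η : ℝ, 0 < η → ∀ᶠ ε in 𝓝[>] (0 : ℝ), ∀ v ∈ ball (0 : ℂ) R,
      ‖H₂ ε v - h₂ z₀‖ ≤ η :=
    fun η hη => eventually_norm_rescale_sub_le hr₀ hc₂ hχ₂ hδ R hη
  have hEd : ∀ᶠ ε in 𝓝[>] (0 : ℝ), DifferentiableOn ℂ (E ε) (ball 0 R) := by
    filter_upwards [hpos, eventually_forall_add_sqrt_mul_mem_ball (z₀ := z₀) hδ R hr₀]
      with ε hε hmem
    have hp : DifferentiableOn ℂ (p ε) (ball 0 R) := by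
      simp only [p]
      fun_prop
    have d1 : DifferentiableOn ℂ (H₁ ε) (ball 0 R) :=
      (hh₁.comp hp hmem).add ((hχ₁diff ε hε).comp hp hmem)
    have d2 : DifferentiableOn ℂ (H₂ ε) (ball 0 R) :=
      (hh₂.comp hp hmem).add ((hχ₂diff ε hε).comp hp hmem)
    exact (differentiableOn_id.mul (d1.const_sub _)).add (d2.const_mul _)
  have hE : ∀ η : ℝ, 0 < η → ∀ᶠ ε in 𝓝[>] (0 : ℝ), ∀ v ∈ ball (0 : ℂ) R, ‖E ε v‖ ≤ η := by
    intro η hη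
    have hlim : Tendsto (fun ε : ℝ => Real.sqrt ε * (‖h₂ z₀‖ + 1)) (𝓝[>] (0 : ℝ)) (𝓝 0) := by
      simpa using hsqrt.mul_const (‖h₂ z₀‖ + 1)
    filter_upwards [hH₁ (η / (2 * R)) (by positivity), hH₂ 1 one_pos,
      hlim.eventually (gt_mem_nhds (half_pos hη))] with ε e1 e2 e3 v hv
    have f1 := e1 v hv
    have f2 := e2 v hv
    rw [mem_ball_zero_iff] at hv
    have f3 : ‖H₂ ε v‖ ≤ ‖h₂ z₀‖ + 1 := by
      have := norm_le_norm_add_norm_sub' (H₂ ε v) (h₂ z₀)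
      linarith
    calc ‖E ε v‖ ≤ ‖v‖ * ‖s ^ 2 - H₁ ε v‖ + ‖(Real.sqrt ε : ℂ)‖ * ‖H₂ ε v‖ := by
          simp only [E, ← norm_mul]
          exact norm_add_le _ _
      _ ≤ R * (η / (2 * R)) + Real.sqrt ε * (‖h₂ z₀‖ + 1) := by
          rw [hs, norm_sub_rev, Complex.norm_real, Real.norm_of_nonneg (Real.sqrt_nonneg ε)]
          gcongr
      _ ≤ η := by
          have : R * (η / (2 * R)) = η / 2 := by field_simp
          linarith
  have hroot : ∀ c : ℂ, ‖c‖ ≤ ‖s‖ → P c = 0 → 3 * c ^ 2 - s ^ 2 ≠ 0 →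
      ∃ ρ : ℝ, 0 < ρ ∧ ∃ V : ℝ → ℂ, Tendsto V (𝓝[>] (0 : ℝ)) (𝓝 c) ∧
      ∀ᶠ ε in 𝓝[>] (0 : ℝ), P (V ε) + E ε (V ε) = 0 ∧
        ∀ v ∈ closedBall c ρ, P v + E ε v = 0 → v = V ε := by
    intro c hc hPc hd
    have hsub : ball c 1 ⊆ ball 0 R := ball_subset_ball' (by
      rw [dist_zero_right]; linarith)
    have hP : HasStrictDerivAt P (3 * c ^ 2 - s ^ 2) c := by
      have h1 := (hasStrictDerivAt_pow 3 c).sub ((hasStrictDerivAt_id c).const_mul (s ^ 2))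
      exact h1.congr_deriv (by norm_num)
    exact hP.exists_tendsto_zero_of_perturbation hd hPc one_pos
      (hEd.mono fun ε h => h.mono hsub) (fun η hη => (hE η hη).mono fun ε h v hv => h v (hsub hv))
  have hs2 : s ^ 2 ≠ 0 := pow_ne_zero 2 hs0
  have h3s : 3 * s ^ 2 - s ^ 2 ≠ 0 := by
    have : 3 * s ^ 2 - s ^ 2 = 2 * s ^ 2 := by ring
    rw [this]
    exact mul_ne_zero two_ne_zero hs2
  obtain ⟨ρm, hρm, Vm, hVm, hm⟩ := hroot (-s) (by simp) (by simp only [P]; ring)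
    (by rwa [neg_sq])
  obtain ⟨ρp, hρp, Vp, hVp, hp⟩ := hroot s le_rfl (by simp only [P]; ring) h3s
  obtain ⟨ρz, hρz, V, hV, hz⟩ := hroot 0 (by simp) (by simp [P]) (by simpa using hs2)
  have heq : ∀ ε : ℝ, 0 < ε → ∀ v : ℂ,
      ((p ε v - (z₀ + δ ε)) ^ 3 - (ε : ℂ) * (p ε v - (z₀ + δ ε)) * (h₁ (p ε v) + χ₁ ε (p ε v))
        + (ε : ℂ) ^ 2 * (h₂ (p ε v) + χ₂ ε (p ε v)) = 0) ↔ P v + E ε v = 0 := by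
    intro ε hε v
    have ht : (Real.sqrt ε : ℂ) ≠ 0 := by
      exact_mod_cast (Real.sqrt_pos.2 hε).ne'
    have ht2 : (ε : ℂ) = (Real.sqrt ε : ℂ) ^ 2 := by
      exact_mod_cast (Real.sq_sqrt hε.le).symm
    have hid : (p ε v - (z₀ + δ ε)) ^ 3
        - (ε : ℂ) * (p ε v - (z₀ + δ ε)) * (h₁ (p ε v) + χ₁ ε (p ε v))
        + (ε : ℂ) ^ 2 * (h₂ (p ε v) + χ₂ ε (p ε v))
        = (Real.sqrt ε : ℂ) ^ 3 * (P v + E ε v) := by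
      have hpv : p ε v - (z₀ + δ ε) = (Real.sqrt ε : ℂ) * v := by simp only [p]; ring
      rw [hpv, ht2]
      simp only [P, E, H₁, H₂]
      ring
    rw [hid, mul_eq_zero, or_iff_right (pow_ne_zero 3 ht)]
  have hbound : ∀ᶠ ε in 𝓝[>] (0 : ℝ), ∀ v : ℂ, p ε v ∈ ball z₀ (r₀ / 2) → P v + E ε v = 0 →
      v ∈ ball (0 : ℂ) R := by
    filter_upwards [hχ₁ 1 one_pos, hχ₂ 1 one_pos, hsqrt.eventually (gt_mem_nhds one_pos)]
      with ε e1 e2 e3 v hv h0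
    have f1 : ‖H₁ ε v‖ ≤ M := by
      have g1 := hM₁ _ (ball_subset_closedBall hv)
      have g2 := e1 _ (hsubr hv)
      have g3 := le_max_left M₁ M₂
      exact (norm_add_le _ _).trans (by linarith)
    have f2 : ‖H₂ ε v‖ ≤ M := by
      have g1 := hM₂ _ (ball_subset_closedBall hv)
      have g2 := e2 _ (hsubr hv)
      have g3 := le_max_right M₁ M₂
      exact (norm_add_le _ _).trans (by linarith)
    have f3 : ‖(Real.sqrt ε : ℂ) * H₂ ε v‖ ≤ M := by
      rw [norm_mul, Complex.norm_real, Real.norm_of_nonneg (Real.sqrt_nonneg ε)]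
      calc Real.sqrt ε * ‖H₂ ε v‖ ≤ 1 * M := by gcongr
        _ = M := one_mul M
    have h0' : v ^ 3 - v * H₁ ε v + (Real.sqrt ε : ℂ) * H₂ ε v = 0 := by
      rw [← h0]
      simp only [P, E]
      ring
    have := norm_le_of_cube_eq f1 f3 h0'
    rw [mem_ball_zero_iff]
    have := norm_nonneg s
    linarith
  have hpt : ∀ {W : ℝ → ℂ} {c : ℂ}, Tendsto W (𝓝[>] (0 : ℝ)) (𝓝 c) →
      ∀ᶠ ε in 𝓝[>] (0 : ℝ), p ε (W ε) ∈ ball z₀ (r₀ / 2) := by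
    intro W c hW
    have : Tendsto (fun ε => p ε (W ε)) (𝓝[>] (0 : ℝ)) (𝓝 z₀) := by
      simpa [p] using (hδ.const_add z₀).add (hsqrtC.mul hW)
    exact this (ball_mem_nhds z₀ (half_pos hr₀))
  have hne_of : ∀ {W W' : ℝ → ℂ} {c c' : ℂ}, Tendsto W (𝓝[>] (0 : ℝ)) (𝓝 c) →
      Tendsto W' (𝓝[>] (0 : ℝ)) (𝓝 c') → c ≠ c' →
      ∀ᶠ ε in 𝓝[>] (0 : ℝ), p ε (W ε) ≠ p ε (W' ε) := by
    intro W W' c c' hW hW' hcc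
    filter_upwards [hpos, (hW.sub hW').eventually_ne (sub_ne_zero.2 hcc)] with ε hε hn h
    have ht : (Real.sqrt ε : ℂ) ≠ 0 := by
      exact_mod_cast (Real.sqrt_pos.2 hε).ne'
    exact hn (sub_eq_zero.2 <| mul_left_cancel₀ ht (add_left_cancel h))
  have hsm : -s ≠ s := fun h => hs0 (self_eq_neg.1 h.symm)
  have hall : ∀ᶠ ε in 𝓝[>] (0 : ℝ),
      (p ε (Vm ε) ∈ ball z₀ (r₀ / 2) ∧ p ε (Vp ε) ∈ ball z₀ (r₀ / 2)
        ∧ p ε (V ε) ∈ ball z₀ (r₀ / 2)) ∧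
      (p ε (Vm ε) ≠ p ε (Vp ε) ∧ p ε (Vm ε) ≠ p ε (V ε) ∧ p ε (Vp ε) ≠ p ε (V ε)) ∧
      (∀ w, (w = p ε (Vm ε) ∨ w = p ε (Vp ε) ∨ w = p ε (V ε)) →
          (w - (z₀ + δ ε)) ^ 3
            - (ε : ℂ) * (w - (z₀ + δ ε)) * (h₁ w + χ₁ ε w)
            + (ε : ℂ) ^ 2 * (h₂ w + χ₂ ε w) = 0) ∧
      (∀ z ∈ ball z₀ (r₀ / 2),
          (z - (z₀ + δ ε)) ^ 3
            - (ε : ℂ) * (z - (z₀ + δ ε)) * (h₁ z + χ₁ ε z)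
            + (ε : ℂ) ^ 2 * (h₂ z + χ₂ ε z) = 0 →
          z = p ε (Vm ε) ∨ z = p ε (Vp ε) ∨ z = p ε (V ε)) := by
    filter_upwards [hpos, hpt hVm, hpt hVp, hpt hV, hne_of hVm hVp hsm,
      hne_of hVm hV (neg_ne_zero.2 hs0), hne_of hVp hV hs0, hm, hp, hz, hbound,
      hE (ρm * ρp * ρz) (by positivity)]
      with ε hε b1 b2 b3 n1 n2 n3 hm hp hz hb hEε
    refine ⟨⟨b1, b2, b3⟩, ⟨n1, n2, n3⟩, ?_, ?_⟩
    · rintro w (rfl | rfl | rfl)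
      · exact (heq ε hε _).2 hm.1
      · exact (heq ε hε _).2 hp.1
      · exact (heq ε hε _).2 hz.1
    · intro z hzb hz0
      have ht : (Real.sqrt ε : ℂ) ≠ 0 := by
        exact_mod_cast (Real.sqrt_pos.2 hε).ne'
      obtain ⟨v, rfl⟩ : ∃ v, z = p ε v :=
        ⟨(z - (z₀ + δ ε)) / (Real.sqrt ε : ℂ), by simp only [p]; field_simp; ring⟩
      have hv0 := (heq ε hε v).1 hz0
      have hPv : ‖v ^ 3 - s ^ 2 * v‖ ≤ ρm * ρp * ρz := by
        have : v ^ 3 - s ^ 2 * v = -E ε v := eq_neg_of_add_eq_zero_left hv0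
        rw [this, norm_neg]
        exact hEε v (hb v hzb hv0)
      rcases norm_le_of_norm_mul_sub_mul_add_le hρm hρp hρz hPv with h | h | h
      · exact Or.inl (by rw [hm.2 v h hv0])
      · exact Or.inr (Or.inl (by rw [hp.2 v h hv0]))
      · exact Or.inr (Or.inr (by rw [hz.2 v h hv0]))
  obtain ⟨ε₀, hε₀, hsubset⟩ := mem_nhdsGT_iff_exists_Ioc_subset.1 hall
  refine ⟨ε₀, hε₀, r₀ / 2, half_pos hr₀, hr, s, hs, fun ε => p ε (Vm ε),
    fun ε => p ε (Vp ε), fun ε => p ε (V ε), fun ε h0 h1 => hsubset ⟨h0, h1⟩, ?_, ?_, ?_⟩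
  · have hlim : Tendsto (fun ε => Vm ε + s) (𝓝[>] (0 : ℝ)) (𝓝 0) := by
      simpa using hVm.add_const s
    refine hlim.congr' ?_
    filter_upwards [hpos] with ε hε
    have ht : (Real.sqrt ε : ℂ) ≠ 0 := by
      exact_mod_cast (Real.sqrt_pos.2 hε).ne'
    simp only [p]
    field_simp
    ring
  · have hlim : Tendsto (fun ε => Vp ε - s) (𝓝[>] (0 : ℝ)) (𝓝 0) := by
      simpa using hVp.sub_const s
    refine hlim.congr' ?_
    filter_upwards [hpos] with ε hε
    have ht : (Real.sqrt ε : ℂ) ≠ 0 := by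
      exact_mod_cast (Real.sqrt_pos.2 hε).ne'
    simp only [p]
    field_simp
    ring
  · have hVR : ∀ᶠ ε in 𝓝[>] (0 : ℝ), V ε ∈ ball (0 : ℂ) R := hV (ball_mem_nhds 0 hRpos)
    have l1 : Tendsto (fun ε => H₁ ε (V ε)) (𝓝[>] (0 : ℝ)) (𝓝 (h₁ z₀)) := by
      rw [Metric.nhds_basis_closedBall.tendsto_right_iff]
      intro η hη
      filter_upwards [hVR, hH₁ η hη] with ε e1 e2
      simpa [dist_eq_norm] using e2 _ e1
    have l2 : Tendsto (fun ε => H₂ ε (V ε)) (𝓝[>] (0 : ℝ)) (𝓝 (h₂ z₀)) := by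
      rw [Metric.nhds_basis_closedBall.tendsto_right_iff]
      intro η hη
      filter_upwards [hVR, hH₂ η hη] with ε e1 e2
      simpa [dist_eq_norm] using e2 _ e1
    have l3 : Tendsto (fun ε => H₁ ε (V ε) - V ε ^ 2) (𝓝[>] (0 : ℝ)) (𝓝 (h₁ z₀)) := by
      simpa using l1.sub (hV.pow 2)
    have l4 : Tendsto (fun ε => H₂ ε (V ε) / (H₁ ε (V ε) - V ε ^ 2) - h₂ z₀ / h₁ z₀)
        (𝓝[>] (0 : ℝ)) (𝓝 0) := by
      simpa using (l2.div l3 hne).sub_const (h₂ z₀ / h₁ z₀)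
    refine l4.congr' ?_
    filter_upwards [hpos, hz, l3.eventually_ne hne] with ε hε hz hD
    have ht : (Real.sqrt ε : ℂ) ≠ 0 := by
      exact_mod_cast (Real.sqrt_pos.2 hε).ne'
    have ht2 : (ε : ℂ) = (Real.sqrt ε : ℂ) ^ 2 := by
      exact_mod_cast (Real.sq_sqrt hε.le).symm
    have hVeq : V ε * (H₁ ε (V ε) - V ε ^ 2) = (Real.sqrt ε : ℂ) * H₂ ε (V ε) := by
      have := hz.1
      simp only [P, E] at this
      linear_combination -this
    have hq : H₂ ε (V ε) / (H₁ ε (V ε) - V ε ^ 2) = V ε / (Real.sqrt ε : ℂ) := by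
      rw [div_eq_div_iff hD ht]
      linear_combination -hVeq
    rw [hq, ht2]
    simp only [p]
    generalize h₂ z₀ / h₁ z₀ = q
    field_simp
    ring
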